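/- Let k and m be positive integers and let s be an integer such that (s, m^k)_k = 1 (i.e., s and m^k are k-th power relatively prime). Then the sum of (a-s, m^k)_k over all integers a with 1 ≤ a ≤ m^k and (a, m^k)_k = 1 equals d(m)·φ^(k)(m). (Rao's identity.) -/

import Mathlib

/-- The k-th power greatest common divisor `(a,b)_k`: the largest k-th power `d^k`
(with `d` a positive integer) dividing both `a` and `b`. -/
noncomputable def kgcd (k : ℕ) (a b : ℤ) : ℕ :=
  sSup {n : ℕ | (∃ d : ℕ, 0 < d ∧ n = d ^ k) ∧ (n : ℤ) ∣ a ∧ (n : ℤ) ∣ b}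

/-- The Eckford Cohen totient function `φ^(k)(m)`: the number of integers `a` with
`1 ≤ a ≤ m^k` and `(a, m^k)_k = 1`. -/
noncomputable def cohenTotient (k m : ℕ) : ℕ :=
  ((Finset.Icc 1 (m ^ k)).filter fun a : ℕ => kgcd k (a : ℤ) ((m : ℤ) ^ k) = 1).card

open Classical in
/-- The base of the k-th power gcd. -/
noncomputable def kroot (k m : ℕ) (a : ℤ) : ℕ :=
  (m.divisors.filter (fun d : ℕ => (d : ℤ) ^ k ∣ a)).lcm id

lemma lcm_pow_dvd_aux (k : ℕ) (x y n : ℕ) (hx : x ^ k ∣ n) (hy : y ^ k ∣ n) :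
    (Nat.lcm x y) ^ k ∣ n := by
  rw [← Nat.pow_lcm_pow]
  exact Nat.lcm_dvd hx hy

lemma kroot_dvd (k m : ℕ) (hm : 0 < m) (a : ℤ) (d : ℕ) :
    d ∣ kroot k m a ↔ d ∣ m ∧ (d : ℤ) ^ k ∣ a := by
  classical
  constructor
  · intro h
    have key : ∀ S : Finset ℕ, (∀ e ∈ S, e ∣ m ∧ (e : ℤ) ^ k ∣ a) →
        S.lcm id ∣ m ∧ ((S.lcm id : ℕ) : ℤ) ^ k ∣ a := by
      intro S
      induction S using Finset.induction_on with
      | empty => intro _; simp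
      | insert x S hx ih =>
        intro hS
        have h1 := hS x (Finset.mem_insert_self _ _)
        have h2 := ih (fun e he => hS e (Finset.mem_insert_of_mem he))
        rw [Finset.lcm_insert]
        refine ⟨Nat.lcm_dvd h1.1 h2.1, ?_⟩
        have h3 := h1.2
        have h4 := h2.2
        rw [← Nat.cast_pow, Int.natCast_dvd] at h3 h4 ⊢
        exact lcm_pow_dvd_aux k x _ _ h3 h4
    have h5 := key (m.divisors.filter (fun d : ℕ => (d : ℤ) ^ k ∣ a)) (by
      intro e he
      simp only [Finset.mem_filter, Nat.mem_divisors] at he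
      exact ⟨he.1.1, he.2⟩)
    refine ⟨h.trans h5.1, ?_⟩
    refine (pow_dvd_pow_of_dvd (Int.natCast_dvd_natCast.mpr h) k).trans h5.2
  · rintro ⟨h1, h2⟩
    have : d ∈ m.divisors.filter (fun d : ℕ => (d : ℤ) ^ k ∣ a) := by
      simp [h1, h2, hm.ne']
    exact Finset.dvd_lcm (f := id) this

lemma kroot_pos (k m : ℕ) (hm : 0 < m) (a : ℤ) : 0 < kroot k m a :=
  Nat.pos_of_dvd_of_pos ((kroot_dvd k m hm a _).1 dvd_rfl).1 hm

lemma kgcd_eq (k m : ℕ) (hk : 0 < k) (hm : 0 < m) (a : ℤ) :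
    kgcd k a ((m : ℤ) ^ k) = kroot k m a ^ k := by
  apply IsGreatest.csSup_eq
  constructor
  · have h := (kroot_dvd k m hm a _).1 dvd_rfl
    refine ⟨⟨_, kroot_pos k m hm a, rfl⟩, ?_, ?_⟩
    · push_cast; exact h.2
    · exact_mod_cast pow_dvd_pow_of_dvd h.1 k
  · rintro n ⟨⟨d, hd, rfl⟩, h1, h2⟩
    push_cast at h1
    have h3 : d ^ k ∣ m ^ k := by exact_mod_cast h2
    have h4 : d ∣ m := (Nat.pow_dvd_pow_iff hk.ne').1 h3
    have h5 := (kroot_dvd k m hm a d).2 ⟨h4, h1⟩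
    exact Nat.pow_le_pow_left (Nat.le_of_dvd (kroot_pos k m hm a) h5) k

lemma kgcd_one_iff (k m : ℕ) (hk : 0 < k) (hm : 0 < m) (a : ℤ) :
    kgcd k a ((m : ℤ) ^ k) = 1 ↔ kroot k m a = 1 := by
  rw [kgcd_eq k m hk hm]
  exact Nat.pow_eq_one.trans (by simp [hk.ne'])

lemma kroot_one_iff (k m : ℕ) (hm : 0 < m) (a : ℤ) :
    kroot k m a = 1 ↔ ∀ p : ℕ, p.Prime → p ∣ m → ¬ (p : ℤ) ^ k ∣ a := by
  rw [Nat.eq_one_iff_not_exists_prime_dvd]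
  simp only [kroot_dvd k m hm, not_and]

lemma totient_eq (k m : ℕ) (hk : 0 < k) (hm : 0 < m) :
    cohenTotient k m =
      ((Finset.Icc 1 (m ^ k)).filter fun a : ℕ => kroot k m (a : ℤ) = 1).card := by
  unfold cohenTotient
  simp only [kgcd_one_iff k m hk hm]

lemma kroot_mul (k e f : ℕ) (he : 0 < e) (hf : 0 < f) (b : ℤ) :
    kroot k (e * f) ((e : ℤ) ^ k * b) = e * kroot k f b := by
  have hef : 0 < e * f := Nat.mul_pos he hf
  have he0 : ((e : ℤ) ^ k) ≠ 0 := by positivity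
  apply Nat.dvd_antisymm
  · obtain ⟨x, hx⟩ : e ∣ kroot k (e * f) ((e : ℤ) ^ k * b) :=
      (kroot_dvd k _ hef _ _).2 ⟨dvd_mul_right _ _, dvd_mul_right _ _⟩
    have h := (kroot_dvd k _ hef _ _).1 (dvd_refl (kroot k (e * f) ((e : ℤ) ^ k * b)))
    rw [hx] at h ⊢
    apply Nat.mul_dvd_mul_left
    rw [kroot_dvd k f hf]
    refine ⟨Nat.dvd_of_mul_dvd_mul_left he h.1, ?_⟩
    have h2 := h.2
    push_cast at h2
    rw [mul_pow] at h2
    exact (mul_dvd_mul_iff_left he0).1 h2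
  · have h := (kroot_dvd k _ hf b _).1 dvd_rfl
    rw [kroot_dvd k _ hef]
    refine ⟨Nat.mul_dvd_mul_left _ h.1, ?_⟩
    push_cast
    rw [mul_pow]
    exact mul_dvd_mul_left _ h.2

lemma fiber_card (k e f : ℕ) (hk : 0 < k) (he : 0 < e) (hf : 0 < f) :
    ((Finset.Icc 1 ((e * f) ^ k)).filter fun a : ℕ => kroot k (e * f) (a : ℤ) = e).card =
      cohenTotient k f := by
  rw [totient_eq k f hk hf]
  symm
  have hek : 0 < e ^ k := by positivity
  apply Finset.card_bij (fun b _ => e ^ k * b)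
  · intro b hb
    simp only [Finset.mem_filter, Finset.mem_Icc] at hb ⊢
    refine ⟨⟨Nat.mul_pos hek hb.1.1, ?_⟩, ?_⟩
    · rw [mul_pow]; exact Nat.mul_le_mul_left _ hb.1.2
    · push_cast
      rw [kroot_mul k e f he hf, hb.2, mul_one]
  · intro b _ c _ h
    exact Nat.eq_of_mul_eq_mul_left hek h
  · intro a ha
    simp only [Finset.mem_filter, Finset.mem_Icc] at ha
    have h := ((kroot_dvd k (e * f) (Nat.mul_pos he hf) a e).1 (by rw [ha.2])).2
    have h' : e ^ k ∣ a := by exact_mod_cast h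
    obtain ⟨b, rfl⟩ := h'
    refine ⟨b, ?_, rfl⟩
    simp only [Finset.mem_filter, Finset.mem_Icc]
    refine ⟨⟨Nat.pos_of_mul_pos_left ha.1.1, ?_⟩, ?_⟩
    · have := ha.1.2
      rw [mul_pow] at this
      exact Nat.le_of_mul_le_mul_left this hek
    · have h2 := ha.2
      push_cast at h2
      rw [kroot_mul k e f he hf] at h2
      exact Nat.eq_of_mul_eq_mul_left he (by rw [h2, mul_one])

lemma sum_totient (k n : ℕ) (hk : 0 < k) (hn : 0 < n) :
    ∑ d ∈ n.divisors, cohenTotient k d = n ^ k := by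
  rw [← Nat.sum_div_divisors n (cohenTotient k)]
  have h := Finset.card_eq_sum_card_fiberwise (s := Finset.Icc 1 (n ^ k)) (t := n.divisors)
    (f := fun a : ℕ => kroot k n (a : ℤ)) (by
      intro a _
      simp only [Finset.mem_coe, Nat.mem_divisors]
      exact ⟨((kroot_dvd k n hn _ _).1 dvd_rfl).1, hn.ne'⟩)
  rw [Nat.card_Icc, Nat.add_sub_cancel] at h
  rw [h]
  apply Finset.sum_congr rfl
  intro e he
  obtain ⟨f, rfl⟩ := Nat.dvd_of_mem_divisors he
  have he0 : 0 < e := Nat.pos_of_mul_pos_right hn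
  have hf0 : 0 < f := Nat.pos_of_mul_pos_left hn
  rw [Nat.mul_div_cancel_left f he0, fiber_card k e f hk he0 hf0]

lemma exists_shift (k m d : ℕ) (hd : 0 < d) (z : ℤ) :
    ∃ t : ℕ, (d : ℤ) ^ k ∣ (t : ℤ) - z ∧
      ∀ p : ℕ, p.Prime → p ∣ m → m ≠ 0 → ¬ p ∣ d → (p : ℤ) ^ k ∣ (t : ℤ) := by
  classical
  set q := ∏ p ∈ m.primeFactors.filter (fun p => ¬ p ∣ d), p with hq
  have hc : Nat.Coprime (d ^ k) (q ^ k) := by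
    apply Nat.Coprime.pow
    apply Nat.Coprime.prod_right
    intro p hp
    simp only [Finset.mem_filter] at hp
    exact ((Nat.Prime.coprime_iff_not_dvd (Nat.prime_of_mem_primeFactors hp.1)).2 hp.2).symm
  obtain ⟨t, ht1, ht2⟩ := Nat.chineseRemainder hc ((z % ((d : ℤ) ^ k)).toNat) 0
  refine ⟨t, ?_, ?_⟩
  · have hD : ((d : ℤ) ^ k) ≠ 0 := by positivity
    have h1 : ((z % ((d : ℤ) ^ k)).toNat : ℤ) = z % ((d : ℤ) ^ k) :=
      Int.toNat_of_nonneg (Int.emod_nonneg _ hD)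
    have h2 := (Int.natCast_modEq_iff.2 ht1)
    rw [h1] at h2
    push_cast at h2
    exact (h2.trans (Int.mod_modEq _ _)).symm.dvd
  · intro p hp hpm hm0 hpd
    have h1 : q ^ k ∣ t := (Nat.modEq_zero_iff_dvd).1 ht2
    have h2 : p ∣ q := Finset.dvd_prod_of_mem (fun p => p) (by
      simp only [Finset.mem_filter, Nat.mem_primeFactors]
      exact ⟨⟨hp, hpm, hm0⟩, hpd⟩)
    exact_mod_cast (pow_dvd_pow_of_dvd h2 k).trans h1

lemma kroot_periodic (k m : ℕ) (hm : 0 < m) (a b : ℤ) (h : (m : ℤ) ^ k ∣ a - b) :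
    kroot k m a = kroot k m b := by
  have aux : ∀ a b : ℤ, (m : ℤ) ^ k ∣ a - b → kroot k m a ∣ kroot k m b := by
    intro a b h
    have h1 := (kroot_dvd k m hm a _).1 dvd_rfl
    rw [kroot_dvd k m hm b]
    refine ⟨h1.1, ?_⟩
    have h2 := (pow_dvd_pow_of_dvd (Int.natCast_dvd_natCast.mpr h1.1) k).trans h
    exact (dvd_iff_dvd_of_dvd_sub h2).1 h1.2
  exact Nat.dvd_antisymm (aux a b h) (aux b a (by rw [← neg_sub]; exact (dvd_neg).2 h))

open Classical in
lemma cnt_shift (M t : ℕ) (P : ℕ → Prop) (hP : Function.Periodic P M) :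
    ((Finset.Icc 1 M).filter fun a => P (a + t)).card = ((Finset.Icc 1 M).filter P).card := by
  have h1 : ((Finset.Ico (1 + t) (1 + t + M)).filter P).card =
      ((Finset.Ico 1 (1 + M)).filter P).card := by
    rw [Nat.filter_Ico_card_eq_of_periodic _ _ _ hP, Nat.filter_Ico_card_eq_of_periodic _ _ _ hP]
  have h2 : Finset.Icc 1 M = Finset.Ico 1 (1 + M) := by
    ext x; simp only [Finset.mem_Icc, Finset.mem_Ico]; omega
  rw [h2, ← h1]
  apply Finset.card_bij (fun a _ => a + t)
  · intro a ha
    simp only [Finset.mem_filter, Finset.mem_Ico] at ha ⊢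
    exact ⟨by omega, ha.2⟩
  · intro a _ b _ h
    exact Nat.add_right_cancel h
  · intro b hb
    simp only [Finset.mem_filter, Finset.mem_Ico] at hb
    refine ⟨b - t, ?_, by omega⟩
    simp only [Finset.mem_filter, Finset.mem_Ico]
    refine ⟨by omega, ?_⟩
    rw [Nat.sub_add_cancel (by omega)]
    exact hb.2

open Classical in
lemma cnt_invariant (k m d : ℕ) (hm : 0 < m) (hdm : d ∣ m) (s s' : ℤ)
    (hs : kroot k d s = 1) (hs' : kroot k d s' = 1) :
    ((Finset.Icc 1 (m ^ k)).filter fun a : ℕ =>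
      kroot k m (a : ℤ) = 1 ∧ (d : ℤ) ^ k ∣ (a : ℤ) - s).card =
    ((Finset.Icc 1 (m ^ k)).filter fun a : ℕ =>
      kroot k m (a : ℤ) = 1 ∧ (d : ℤ) ^ k ∣ (a : ℤ) - s').card := by
  have hd : 0 < d := Nat.pos_of_dvd_of_pos hdm hm
  obtain ⟨t, ht1, ht2⟩ := exists_shift k m d hd (s' - s)
  have hper : Function.Periodic (fun a : ℕ =>
      kroot k m (a : ℤ) = 1 ∧ (d : ℤ) ^ k ∣ (a : ℤ) - s') (m ^ k) := by
    intro a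
    have e1 : kroot k m ((a + m ^ k : ℕ) : ℤ) = kroot k m (a : ℤ) := by
      apply kroot_periodic k m hm
      push_cast
      simp
    have e2 : (d : ℤ) ^ k ∣ ((a + m ^ k : ℕ) : ℤ) - s' ↔ (d : ℤ) ^ k ∣ (a : ℤ) - s' := by
      apply dvd_iff_dvd_of_dvd_sub
      push_cast
      have : (d : ℤ) ^ k ∣ (m : ℤ) ^ k := pow_dvd_pow_of_dvd (Int.natCast_dvd_natCast.mpr hdm) k
      obtain ⟨c, hc⟩ := this
      exact ⟨c, by linarith⟩
    simp only [e1, e2]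
  refine Eq.trans ?_ (Eq.trans (cnt_shift (m ^ k) t _ hper) ?_)
  swap
  · congr!
  congr 1
  ext a
  simp only [Finset.mem_filter]
  apply and_congr_right
  intro _
  have hD : (d : ℤ) ^ k ∣ (a : ℤ) - s ↔ (d : ℤ) ^ k ∣ ((a + t : ℕ) : ℤ) - s' := by
    apply dvd_iff_dvd_of_dvd_sub
    rw [← dvd_neg]
    obtain ⟨c, hc⟩ := ht1
    exact ⟨c, by push_cast; linarith⟩
  rw [← hD]
  apply and_congr_left
  intro has
  have has' := hD.1 has
  rw [kroot_one_iff k m hm, kroot_one_iff k m hm]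
  rw [kroot_one_iff k d hd] at hs hs'
  refine forall_congr' fun p => forall_congr' fun hp => forall_congr' fun hpm => ?_
  by_cases hpd : p ∣ d
  · have hpk : (p : ℤ) ^ k ∣ (d : ℤ) ^ k := pow_dvd_pow_of_dvd (Int.natCast_dvd_natCast.mpr hpd) k
    have h1 : ¬ (p : ℤ) ^ k ∣ (a : ℤ) :=
      fun h => hs p hp hpd ((dvd_iff_dvd_of_dvd_sub (hpk.trans has)).1 h)
    have h2 : ¬ (p : ℤ) ^ k ∣ ((a + t : ℕ) : ℤ) :=
      fun h => hs' p hp hpd ((dvd_iff_dvd_of_dvd_sub (hpk.trans has')).1 h)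
    exact iff_of_true h1 h2
  · have h := ht2 p hp hpm hm.ne' hpd
    push_cast
    rw [dvd_add_left h]

open Classical in
lemma totient_mul_cnt (k m d : ℕ) (hk : 0 < k) (hm : 0 < m) (hdm : d ∣ m) (s : ℤ)
    (hs : kroot k d s = 1) :
    cohenTotient k d * ((Finset.Icc 1 (m ^ k)).filter fun a : ℕ =>
      kroot k m (a : ℤ) = 1 ∧ (d : ℤ) ^ k ∣ (a : ℤ) - s).card = cohenTotient k m := by
  have hd : 0 < d := Nat.pos_of_dvd_of_pos hdm hm
  have hD : 0 < d ^ k := by positivity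
  have hrep : ∀ a : ℕ, 1 ≤ a → (d : ℤ) ^ k ∣ (a : ℤ) - (((a - 1) % d ^ k + 1 : ℕ) : ℤ) := by
    intro a ha
    refine ⟨(((a - 1) / d ^ k : ℕ) : ℤ), ?_⟩
    have h : d ^ k * ((a - 1) / d ^ k) + (a - 1) % d ^ k = a - 1 := Nat.div_add_mod _ _
    have h2 : a = d ^ k * ((a - 1) / d ^ k) + ((a - 1) % d ^ k + 1) := by omega
    have h3 : (a : ℤ) = (d : ℤ) ^ k * (((a - 1) / d ^ k : ℕ) : ℤ)
        + (((a - 1) % d ^ k + 1 : ℕ) : ℤ) := by exact_mod_cast h2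
    linarith
  rw [totient_eq k m hk hm, totient_eq k d hk hd]
  rw [Finset.card_eq_sum_card_fiberwise (f := fun a : ℕ => (a - 1) % d ^ k + 1)
    (s := (Finset.Icc 1 (m ^ k)).filter fun a : ℕ => kroot k m (a : ℤ) = 1)
    (t := (Finset.Icc 1 (d ^ k)).filter fun a : ℕ => kroot k d (a : ℤ) = 1)]
  · rw [← smul_eq_mul, ← Finset.sum_const]
    apply Finset.sum_congr rfl
    intro b hb
    simp only [Finset.mem_filter, Finset.mem_Icc] at hb
    rw [cnt_invariant k m d hm hdm s b hs hb.2, Finset.filter_filter]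
    congr 1
    apply Finset.filter_congr
    intro a ha
    rw [Finset.mem_Icc] at ha
    apply and_congr_right
    intro _
    have hr := hrep a ha.1
    constructor
    · intro h
      have h3 : (d : ℤ) ^ k ∣ (((a - 1) % d ^ k + 1 : ℕ) : ℤ) - (b : ℤ) := by
        obtain ⟨c, hc⟩ := dvd_sub h hr
        exact ⟨c, by linarith⟩
      have hlt := Nat.mod_lt (a - 1) hD
      have h4 : (((a - 1) % d ^ k + 1 : ℕ) : ℤ) - (b : ℤ) = 0 := by
        apply Int.eq_zero_of_abs_lt_dvd h3
        have e1 : (((a - 1) % d ^ k + 1 : ℕ) : ℤ) ≤ (d : ℤ) ^ k := by exact_mod_cast hlt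
        have e2 : (b : ℤ) ≤ (d : ℤ) ^ k := by exact_mod_cast hb.1.2
        have e3 : (1 : ℤ) ≤ (b : ℤ) := by exact_mod_cast hb.1.1
        have e4 : (1 : ℤ) ≤ (((a - 1) % d ^ k + 1 : ℕ) : ℤ) := by
          exact_mod_cast Nat.le_add_left 1 _
        rw [abs_lt]
        constructor <;> linarith
      have h5 : (((a - 1) % d ^ k + 1 : ℕ) : ℤ) = (b : ℤ) := by linarith
      exact_mod_cast h5
    · intro h
      rw [h] at hr
      exact hr
  · intro a ha
    simp only [Finset.coe_filter, Finset.mem_Icc, Set.mem_ofPred_eq] at ha ⊢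
    have hlt := Nat.mod_lt (a - 1) hD
    refine ⟨⟨Nat.le_add_left 1 _, hlt⟩, ?_⟩
    rw [← kroot_periodic k d hd _ _ (hrep a ha.1.1)]
    rw [kroot_one_iff k d hd]
    have := (kroot_one_iff k m hm _).1 ha.2
    exact fun p hp hpd => this p hp (hpd.trans hdm)

/-- **Rao's identity.** If `s` and `m^k` are k-th power relatively prime, then the sum of
`(a-s, m^k)_k` over `1 ≤ a ≤ m^k` with `(a, m^k)_k = 1` equals `d(m)·φ^(k)(m)`. -/
theorem rao_identity (k m : ℕ) (hk : 0 < k) (hm : 0 < m) (s : ℤ)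
    (hs : kgcd k s ((m : ℤ) ^ k) = 1) :
    ∑ a ∈ (Finset.Icc 1 (m ^ k)).filter (fun a : ℕ => kgcd k (a : ℤ) ((m : ℤ) ^ k) = 1),
      kgcd k ((a : ℤ) - s) ((m : ℤ) ^ k) = m.divisors.card * cohenTotient k m := by
  classical
  have hs1 := (kgcd_one_iff k m hk hm s).1 hs
  simp only [kgcd_one_iff k m hk hm]
  have h1 : ∀ a : ℕ, kgcd k ((a : ℤ) - s) ((m : ℤ) ^ k) =
      ∑ d ∈ m.divisors, if (d : ℤ) ^ k ∣ (a : ℤ) - s then cohenTotient k d else 0 := by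
    intro a
    rw [kgcd_eq k m hk hm, ← sum_totient k _ hk (kroot_pos k m hm _), ← Finset.sum_filter]
    apply Finset.sum_congr _ (fun _ _ => rfl)
    ext d
    simp only [Nat.mem_divisors, Finset.mem_filter, kroot_dvd k m hm]
    have := (kroot_pos k m hm ((a : ℤ) - s)).ne'
    have hm' := hm.ne'
    tauto
  simp only [h1]
  rw [Finset.sum_comm, ← smul_eq_mul, ← Finset.sum_const]
  apply Finset.sum_congr rfl
  intro d hd
  have hdm := Nat.dvd_of_mem_divisors hd
  have hd0 : 0 < d := Nat.pos_of_dvd_of_pos hdm hm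
  rw [← Finset.sum_filter, Finset.sum_const, smul_eq_mul, Finset.filter_filter, mul_comm]
  apply totient_mul_cnt k m d hk hm hdm s
  rw [kroot_one_iff k d hd0]
  exact fun p hp hpd => (kroot_one_iff k m hm s).1 hs1 p hp (hpd.trans hdm)
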